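/- Let s = (q⃗, ε⃗) ∈ RS(S) be a reachable configuration of the composed system S = S1 ⋈_{H,K} S2 in which all buffers are empty, q_H ∉ Q̂_H, q_K ∉ Q̂_K, and neither q_H nor q_K is final. Then either (a) every transition from q_H in δ_H is of the form (q_H, KH?_, _) and every transition from q_K in δ_K is of the form (q_K, sK?_, _) with s ≠ H, or (b) every transition from q_K in δ_K is of the form (q_K, HK?_, _) and every transition from q_H in δ_H is of the form (q_H, sH?_, _) with s ≠ K. -/

import Mathlib

/- Common formalization of Communicating Finite State Machines (CFSMs),
communicating systems, gateways and their composition, following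
"Global Types with Internal Delegation" / GTIR paper definitions. -/

namespace GTIR

/-- Polarity of an action: `!` (send) or `?` (receive). -/
inductive Pol : Type
  | bang
  | query
deriving DecidableEq

/-- Dual polarity: swap `!` and `?`. -/
def Pol.dual : Pol → Pol
  | .bang => .query
  | .query => .bang

/-- Actions over roles `R` and messages `A`:
`snd s r a` is `sr!a` (s sends `a` to r), `rcv s r a` is `sr?a`
(r receives/consumes `a` sent by s). -/
inductive Act (R A : Type) : Type
  | snd : R → R → A → Act R A
  | rcv : R → R → A → Act R A

/-- The action is a send action. -/
def Act.isSend {R A : Type} : Act R A → Prop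
  | .snd _ _ _ => True
  | .rcv _ _ _ => False

/-- The action is a receive action. -/
def Act.isRecv {R A : Type} : Act R A → Prop
  | .snd _ _ _ => False
  | .rcv _ _ _ => True

/-- Erase the channel name of an action: `pq!a ↦ !a`, `pq?a ↦ ?a`. -/
def Act.noC {R A : Type} : Act R A → Pol × A
  | .snd _ _ a => (.bang, a)
  | .rcv _ _ a => (.query, a)

/-- The dual of a word over `{!,?} × A`: swap `!` and `?` pointwise. -/
def dualWord {A : Type} (w : List (Pol × A)) : List (Pol × A) :=
  w.map fun x => (x.1.dual, x.2)

/-- Universal state type: base states from `B`, plus arbitrarily nested fresh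
"hat" states (one for each transition) used by the gateway construction. -/
inductive St (R A B : Type) : Type
  | base : B → St R A B
  | hat : St R A B → Act R A → St R A B → St R A B

/-- A communicating finite state machine over roles `R` and messages `A`,
with states taken from `St R A B`: an initial state together with a
transition relation. -/
structure CFSM (R A B : Type) where
  init : St R A B
  delta : Set (St R A B × Act R A × St R A B)

namespace CFSM

variable {R A B : Type}

/-- A state is final if it has no outgoing transition. -/
def Final (M : CFSM R A B) (q : St R A B) : Prop :=
  ∀ l q', (q, l, q') ∉ M.delta

/-- A sending state: non-final, and all outgoing transitions are sends. -/
def Sending (M : CFSM R A B) (q : St R A B) : Prop :=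
  (∃ l q', (q, l, q') ∈ M.delta) ∧ ∀ l q', (q, l, q') ∈ M.delta → l.isSend

/-- A receiving state: non-final, and all outgoing transitions are receives. -/
def Receiving (M : CFSM R A B) (q : St R A B) : Prop :=
  (∃ l q', (q, l, q') ∈ M.delta) ∧ ∀ l q', (q, l, q') ∈ M.delta → l.isRecv

/-- A mixed state: it has both an outgoing send and an outgoing receive. -/
def Mixed (M : CFSM R A B) (q : St R A B) : Prop :=
  (∃ l q', (q, l, q') ∈ M.delta ∧ l.isSend) ∧
  (∃ l q', (q, l, q') ∈ M.delta ∧ l.isRecv)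

/-- `M` has no mixed states. -/
def NoMixed (M : CFSM R A B) : Prop := ∀ q, ¬ M.Mixed q

/-- `?`-determinism: two receives of the same message from the same state
(possibly on different channels) have the same target. -/
def QDet (M : CFSM R A B) : Prop :=
  ∀ q a s r s' r' q' q'', (q, Act.rcv s r a, q') ∈ M.delta →
    (q, Act.rcv s' r' a, q'') ∈ M.delta → q' = q''

/-- `!`-determinism: two sends of the same message from the same state
(possibly on different channels) have the same target. -/
def BDet (M : CFSM R A B) : Prop :=
  ∀ q a s r s' r' q' q'', (q, Act.snd s r a, q') ∈ M.delta →
    (q, Act.snd s' r' a, q'') ∈ M.delta → q' = q''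

/-- `?!`-determinism. -/
def IODet (M : CFSM R A B) : Prop := M.QDet ∧ M.BDet

/-- Accepting runs from a given state (every state is accepting). -/
inductive Accepts (M : CFSM R A B) : St R A B → List (Act R A) → Prop
  | nil (q : St R A B) : Accepts M q []
  | cons {q : St R A B} {l : Act R A} {q' : St R A B} {φ : List (Act R A)} :
      (q, l, q') ∈ M.delta → Accepts M q' φ → Accepts M q (l :: φ)

/-- The language of `M` over `Act`. -/
def lang (M : CFSM R A B) : Set (List (Act R A)) := {φ | M.Accepts M.init φ}

/-- The language of `M` with channel names erased. -/
def langNoC (M : CFSM R A B) : Set (List (Pol × A)) :=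
  (fun φ => φ.map Act.noC) '' M.lang

/-- Compatibility `M ↔ M'`: the channel-erased language of `M` is the set of
duals of the channel-erased language of `M'`; moreover neither machine has a
mixed state and both are `?!`-deterministic. -/
def Compat (M M' : CFSM R A B) : Prop :=
  M.langNoC = dualWord '' M'.langNoC ∧
  M.NoMixed ∧ M'.NoMixed ∧ M.IODet ∧ M'.IODet

/-- The machine of role `p` over the role set `P`: every transition label is
an action of `p` (a send `pr!a` or a receive `rp?a`) with partner `r ∈ P`. -/
def ActsFor (M : CFSM R A B) (p : R) (P : Set R) : Prop :=
  ∀ q l q', (q, l, q') ∈ M.delta →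
    ∃ r a, r ∈ P ∧ r ≠ p ∧ (l = Act.snd p r a ∨ l = Act.rcv r p a)

/-- All states occurring in `M` are base states; this guarantees that the
intermediate "hat" states of the gateway construction are fresh for `M`. -/
def HatFree (M : CFSM R A B) : Prop :=
  (∃ b, M.init = St.base b) ∧
  ∀ q l q', (q, l, q') ∈ M.delta →
    (∃ b, q = St.base b) ∧ (∃ b, q' = St.base b)

/-- The set `Q̂` of fresh intermediate gateway states of `M`
(one for each transition of `M`). -/
def hatStates (M : CFSM R A B) : Set (St R A B) :=
  {x | ∃ q l q', (q, l, q') ∈ M.delta ∧ x = St.hat q l q'}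

/-- The gateway `gw(M_H, K)` of the machine `M` of role `H` towards role `K`:
each transition `t = (q, Hs!a, q')` of `M` is replaced by
`(q, KH?a, q̂_t)` and `(q̂_t, Hs!a, q')`, and each transition
`t = (q, sH?a, q')` of `M` is replaced by `(q, sH?a, q̂_t)` and
`(q̂_t, HK!a, q')`. -/
def gw (M : CFSM R A B) (H K : R) : CFSM R A B where
  init := M.init
  delta :=
    {x | ∃ q s a q', (q, Act.snd H s a, q') ∈ M.delta ∧
      (x = (q, Act.rcv K H a, St.hat q (Act.snd H s a) q') ∨
       x = (St.hat q (Act.snd H s a) q', Act.snd H s a, q'))} ∪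
    {x | ∃ q s a q', (q, Act.rcv s H a, q') ∈ M.delta ∧
      (x = (q, Act.rcv s H a, St.hat q (Act.rcv s H a) q') ∨
       x = (St.hat q (Act.rcv s H a) q', Act.snd H K a, q'))}

end CFSM

/-- A communicating system: a set of roles together with a CFSM for each role. -/
structure CS (R A B : Type) where
  roles : Set R
  mach : R → CFSM R A B

namespace CS

variable {R A B : Type}

/-- Well-formedness: the machine of each role `p` of the system only carries
actions of `p` with partners among the system's roles. -/
def WF (S : CS R A B) : Prop :=
  ∀ p ∈ S.roles, (S.mach p).ActsFor p S.roles

/-- Each machine of the system has a finite transition relation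
(hence finitely many relevant states). -/
def FiniteSys (S : CS R A B) : Prop :=
  ∀ p ∈ S.roles, (S.mach p).delta.Finite

open scoped Classical in
/-- Composition `S1 ⋈_{H,K} S2`: the union of the two systems, where the
machines of the interface roles `H` and `K` are replaced by the gateways
`gw(M¹_H, K)` and `gw(M²_K, H)`. -/
noncomputable def compose (S1 S2 : CS R A B) (H K : R) : CS R A B where
  roles := S1.roles ∪ S2.roles
  mach := fun p =>
    if p = H then (S1.mach H).gw H K
    else if p = K then (S2.mach K).gw K H
    else if p ∈ S1.roles then S1.mach p
    else S2.mach p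

end CS

/-- A configuration: a local state for every role and a buffer (word over the
messages) for every ordered channel. -/
structure Config (R A B : Type) where
  st : R → St R A B
  buf : R → R → List A

/-- The initial configuration(s) of a system: every machine of the system is
in its initial state and all the system's buffers are empty. -/
def InitConf {R A B : Type} (S : CS R A B) (c : Config R A B) : Prop :=
  (∀ p ∈ S.roles, c.st p = (S.mach p).init) ∧
  (∀ p ∈ S.roles, ∀ q ∈ S.roles, c.buf p q = [])

/-- One asynchronous step of system `S`, labelled by an action:
a send `sr!a` appends `a` to the buffer of channel `sr`, a receive `sr?a`
removes `a` from the front of the buffer of channel `sr`; everything else is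
unchanged. -/
def Step {R A B : Type} (S : CS R A B) (c : Config R A B) :
    Act R A → Config R A B → Prop
  | .snd s r a, c' =>
      s ∈ S.roles ∧ (c.st s, Act.snd s r a, c'.st s) ∈ (S.mach s).delta ∧
      (∀ p, p ≠ s → c'.st p = c.st p) ∧
      c'.buf s r = c.buf s r ++ [a] ∧
      (∀ p q, ¬(p = s ∧ q = r) → c'.buf p q = c.buf p q)
  | .rcv s r a, c' =>
      r ∈ S.roles ∧ (c.st r, Act.rcv s r a, c'.st r) ∈ (S.mach r).delta ∧
      (∀ p, p ≠ r → c'.st p = c.st p) ∧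
      c.buf s r = a :: c'.buf s r ∧
      (∀ p q, ¬(p = s ∧ q = r) → c'.buf p q = c.buf p q)

/-- `RS(S)`: the configurations reachable from the initial configuration. -/
def Reach {R A B : Type} (S : CS R A B) (c : Config R A B) : Prop :=
  ∃ c₀, InitConf S c₀ ∧
    Relation.ReflTransGen (fun x y => ∃ l, Step S x l y) c₀ c

/-- Deadlock configuration: all the system's buffers are empty and every
machine is in a receiving state. -/
def DeadlockConf {R A B : Type} (S : CS R A B) (c : Config R A B) : Prop :=
  (∀ p ∈ S.roles, ∀ q ∈ S.roles, c.buf p q = []) ∧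
  ∀ p ∈ S.roles, (S.mach p).Receiving (c.st p)

/-- A system is deadlock-free if no reachable configuration is a deadlock. -/
def DeadlockFree {R A B : Type} (S : CS R A B) : Prop :=
  ∀ c, Reach S c → ¬ DeadlockConf S c

/-- Orphan-message configuration: every machine is in a final state but some
buffer of the system is non-empty. -/
def OrphanConf {R A B : Type} (S : CS R A B) (c : Config R A B) : Prop :=
  (∀ p ∈ S.roles, (S.mach p).Final (c.st p)) ∧
  ∃ p ∈ S.roles, ∃ q ∈ S.roles, c.buf p q ≠ []

/-- Unspecified reception configuration: some machine is in a receiving state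
but each of its expected input buffers is non-empty and starts with a message
it cannot receive. -/
def UnspecConf {R A B : Type} (S : CS R A B) (c : Config R A B) : Prop :=
  ∃ r ∈ S.roles, (S.mach r).Receiving (c.st r) ∧
    ∀ s a q', (c.st r, Act.rcv s r a, q') ∈ (S.mach r).delta →
      c.buf s r ≠ [] ∧ ∀ w, c.buf s r ≠ a :: w

/-- A system is safe if no reachable configuration is a deadlock,
an orphan-message, or an unspecified reception configuration. -/
def Safe {R A B : Type} (S : CS R A B) : Prop :=
  ∀ c, Reach S c →
    ¬ DeadlockConf S c ∧ ¬ OrphanConf S c ∧ ¬ UnspecConf S c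

end GTIR

open GTIR

namespace GTIRProof

variable {R A B : Type}

/-- projection of a word on a polarity -/
def proj (p : Pol) (w : List (Pol × A)) : List A :=
  (w.filter (fun x => decide (x.1 = p))).map (fun x => x.2)

theorem proj_append (p : Pol) (w v : List (Pol × A)) :
    proj p (w ++ v) = proj p w ++ proj p v := by
  simp [proj]

theorem proj_dual_bang (w : List (Pol × A)) : proj .bang (dualWord w) = proj .query w := by
  induction w with
  | nil => rfl
  | cons x w ih =>
    obtain ⟨p, a⟩ := x
    cases p <;> simpa [proj, dualWord, Pol.dual] using ih

theorem proj_dual_query (w : List (Pol × A)) : proj .query (dualWord w) = proj .bang w := by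
  induction w with
  | nil => rfl
  | cons x w ih =>
    obtain ⟨p, a⟩ := x
    cases p <;> simpa [proj, dualWord, Pol.dual] using ih

inductive Run (M : CFSM R A B) : St R A B → List (Pol × A) → Prop
  | nil : Run M M.init []
  | snoc {q l q' w} : Run M q w → (q, l, q') ∈ M.delta → Run M q' (w ++ [l.noC])

theorem run_snoc_inv {M : CFSM R A B} {q w x} (h : Run M q (w ++ [x])) :
    ∃ q0 l, Run M q0 w ∧ (q0, l, q) ∈ M.delta ∧ l.noC = x := by
  generalize hv : w ++ [x] = v at h
  cases h with
  | nil => simp at hv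
  | snoc h1 h2 =>
    have := List.append_inj' hv rfl
    obtain ⟨rfl, h3⟩ := this
    exact ⟨_, _, h1, h2, by simpa using h3.symm⟩

theorem run_prefix {M : CFSM R A B} {u : List (Pol × A)} (v : List (Pol × A)) :
    ∀ {q}, Run M q (u ++ v) → ∃ q0, Run M q0 u := by
  induction v using List.reverseRecOn with
  | nil => intro q h; exact ⟨q, by simpa using h⟩
  | append_singleton v x ih =>
    intro q h
    rw [← List.append_assoc] at h
    obtain ⟨q0, l, h1, _⟩ := run_snoc_inv h
    exact ih h1

theorem step_det {M : CFSM R A B} (hd : M.IODet) {q l l' q1 q2}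
    (h1 : (q, l, q1) ∈ M.delta) (h2 : (q, l', q2) ∈ M.delta) (he : l.noC = l'.noC) :
    q1 = q2 := by
  cases l <;> cases l' <;> simp [Act.noC] at he
  · subst he; exact hd.2 _ _ _ _ _ _ _ _ h1 h2
  · subst he; exact hd.1 _ _ _ _ _ _ _ _ h1 h2

theorem run_det {M : CFSM R A B} (hd : M.IODet) {q1 w} (h1 : Run M q1 w) :
    ∀ {q2}, Run M q2 w → q1 = q2 := by
  induction h1 with
  | nil =>
    intro q2 h2
    generalize hv : ([] : List (Pol × A)) = v at h2
    cases h2 with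
    | nil => rfl
    | snoc _ _ => simp at hv
  | snoc h ht ih =>
    intro q2 h2
    obtain ⟨q0, l, h3, h4, h5⟩ := run_snoc_inv h2
    have := ih h3
    subst this
    exact step_det hd ht h4 h5.symm

theorem run_of_accepts {M : CFSM R A B} {q φ} (h : M.Accepts q φ) :
    ∀ {w}, Run M q w → ∃ q', Run M q' (w ++ φ.map Act.noC) := by
  induction h with
  | nil q => intro w hw; exact ⟨q, by simpa using hw⟩
  | cons ht _ ih =>
    intro w hw
    obtain ⟨q', h'⟩ := ih (Run.snoc hw ht)
    exact ⟨q', by simpa using h'⟩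

theorem accepts_of_run {M : CFSM R A B} {q w} (h : Run M q w) :
    ∃ φ : List (Act R A), φ.map Act.noC = w ∧
      ∀ ψ, M.Accepts q ψ → M.Accepts M.init (φ ++ ψ) := by
  induction h with
  | nil => exact ⟨[], rfl, fun ψ h => h⟩
  | @snoc q l q' w _ ht ih =>
    obtain ⟨φ, h1, h2⟩ := ih
    refine ⟨φ ++ [l], by simp [h1], fun ψ hψ => ?_⟩
    rw [List.append_assoc]
    exact h2 _ (CFSM.Accepts.cons ht hψ)

theorem mem_lang {M : CFSM R A B} {w} : w ∈ M.langNoC ↔ ∃ q, Run M q w := by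
  constructor
  · rintro ⟨φ, h, rfl⟩
    obtain ⟨q, hq⟩ := run_of_accepts h Run.nil
    exact ⟨q, by simpa using hq⟩
  · rintro ⟨q, h⟩
    obtain ⟨φ, h1, h2⟩ := accepts_of_run h
    exact ⟨φ, by simpa [CFSM.lang] using h2 [] (CFSM.Accepts.nil q), h1⟩

theorem same_pol {M : CFSM R A B} (hm : M.NoMixed) {q l l' q1 q2}
    (h1 : (q, l, q1) ∈ M.delta) (h2 : (q, l', q2) ∈ M.delta) : l.noC.1 = l'.noC.1 := by
  cases l <;> cases l' <;> simp only [Act.noC]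
  · exact absurd ⟨⟨_, _, h1, trivial⟩, ⟨_, _, h2, trivial⟩⟩ (hm q)
  · exact absurd ⟨⟨_, _, h2, trivial⟩, ⟨_, _, h1, trivial⟩⟩ (hm q)

theorem word_eq {M : CFSM R A B} (hm : M.NoMixed) (hd : M.IODet) (w : List (Pol × A)) :
    ∀ (u v : List (Pol × A)) (p q), Run M p (u ++ w) → Run M q (u ++ v) →
      proj .bang w = proj .bang v → proj .query w = proj .query v → w = v := by
  induction w with
  | nil =>
    intro u v p q _ _ h1 h2
    cases v with
    | nil => rfl
    | cons y v =>
      obtain ⟨y, a⟩ := y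
      cases y <;> simp [proj] at h1 h2
  | cons x w ih =>
    intro u v p q hp hq h1 h2
    cases v with
    | nil =>
      obtain ⟨x, a⟩ := x
      cases x <;> simp [proj] at h1 h2
    | cons y v =>
      have hp' : Run M p ((u ++ [x]) ++ w) := by simpa using hp
      have hq' : Run M q ((u ++ [y]) ++ v) := by simpa using hq
      obtain ⟨p0, hp0⟩ := run_prefix _ hp'
      obtain ⟨q0, hq0⟩ := run_prefix _ hq'
      obtain ⟨p1, l, hp1, hl, rfl⟩ := run_snoc_inv hp0
      obtain ⟨q1, l', hq1, hl', rfl⟩ := run_snoc_inv hq0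
      have := run_det hd hp1 hq1
      subst this
      have hs := same_pol hm hl hl'
      have hxy : l.noC = l'.noC ∧ proj .bang w = proj .bang v ∧ proj .query w = proj .query v := by
        cases l <;> cases l' <;> simp [Act.noC] at hs <;>
          simp [proj, Act.noC] at h1 h2 ⊢ <;> tauto
      obtain ⟨he, h3, h4⟩ := hxy
      rw [he] at hp' ⊢
      rw [ih _ v p q hp' hq' h3 h4]

/-- gateway history: `I` messages read from the peer, `O` messages written to the peer -/
def Hist (M : CFSM R A B) (q : St R A B) (I O : List A) : Prop :=
  ∃ w, O = proj .query w ∧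
    ((Run M q w ∧ I = proj .bang w) ∨
     ∃ q0 l q', Run M q0 w ∧ (q0, l, q') ∈ M.delta ∧ q = St.hat q0 l q' ∧
      I = proj .bang w ++ proj .bang [l.noC])

theorem run_base {M : CFSM R A B} (hf : M.HatFree) {q w} (h : Run M q w) :
    ∃ b, q = St.base b := by
  cases h with
  | nil => exact hf.1
  | snoc _ h => exact (hf.2 _ _ _ h).2

theorem gw_step {M : CFSM R A B} {H K : R} {P : Set R} (hf : M.HatFree)
    (ha : M.ActsFor H P) (hKP : K ∉ P) {q l q' I O} (h : Hist M q I O)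
    (ht : (q, l, q') ∈ (M.gw H K).delta) :
    (∃ a, l = Act.rcv K H a ∧ Hist M q' (I ++ [a]) O) ∨
    (∃ a, l = Act.snd H K a ∧ Hist M q' I (O ++ [a])) ∨
    ((∃ s a, s ≠ K ∧ (l = Act.rcv s H a ∨ l = Act.snd H s a)) ∧ Hist M q' I O) := by
  obtain ⟨w, rfl, h⟩ := h
  have hne : ∀ {s a x y}, ((x, Act.snd H s a, y) ∈ M.delta ∨ (x, Act.rcv s H a, y) ∈ M.delta) →
      s ≠ K := by
    rintro s a x y (hx | hx) rfl <;> obtain ⟨r, b, hr, hr', h1 | h1⟩ := ha _ _ _ hx <;>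
      simp at h1 <;> grind
  rcases ht with ⟨q1, s, a, q2, hd, e | e⟩ | ⟨q1, s, a, q2, hd, e | e⟩ <;>
    simp only [Prod.mk.injEq] at e <;> obtain ⟨rfl, rfl, rfl⟩ := e
  · rcases h with ⟨hr, rfl⟩ | ⟨q0, l, q3, _, _, rfl, _⟩
    · left
      exact ⟨a, rfl, w, rfl, Or.inr ⟨_, _, _, hr, hd, rfl, by simp [proj, Act.noC]⟩⟩
    · obtain ⟨b, hb⟩ := (hf.2 _ _ _ hd).1
      cases hb
  · rcases h with ⟨hr, rfl⟩ | ⟨q0, l, q3, hr, hd', e, rfl⟩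
    · obtain ⟨b, hb⟩ := run_base hf hr
      cases hb
    · cases e
      right; right
      refine ⟨⟨s, a, hne (Or.inl hd), Or.inr rfl⟩, _, ?_, Or.inl ⟨Run.snoc hr hd, ?_⟩⟩ <;>
        simp [proj, Act.noC]
  · rcases h with ⟨hr, rfl⟩ | ⟨q0, l, q3, _, _, rfl, _⟩
    · right; right
      exact ⟨⟨s, a, hne (Or.inr hd), Or.inl rfl⟩, w, rfl,
        Or.inr ⟨_, _, _, hr, hd, rfl, by simp [proj, Act.noC]⟩⟩
    · obtain ⟨b, hb⟩ := (hf.2 _ _ _ hd).1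
      cases hb
  · rcases h with ⟨hr, rfl⟩ | ⟨q0, l, q3, hr, hd', e, rfl⟩
    · obtain ⟨b, hb⟩ := run_base hf hr
      cases hb
    · cases e
      right; left
      refine ⟨a, rfl, _, ?_, Or.inl ⟨Run.snoc hr hd, ?_⟩⟩ <;>
        simp [proj, Act.noC]

/-- the invariant, for an abstract system having gateways at `H` and `K` -/
def Inv (M N : CFSM R A B) (H K : R) (c : Config R A B) : Prop :=
  ∃ I O I' O', Hist M (c.st H) I O ∧ Hist N (c.st K) I' O' ∧
    O' = I ++ c.buf K H ∧ O = I' ++ c.buf H K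

theorem inv_symm {M N : CFSM R A B} {H K : R} {c : Config R A B} (h : Inv M N H K c) :
    Inv N M K H c := by
  obtain ⟨I, O, I', O', h1, h2, h3, h4⟩ := h
  exact ⟨I', O', I, O, h2, h1, h4, h3⟩

theorem act_subj {M : CFSM R A B} {H K : R} {q l q'}
    (ht : (q, l, q') ∈ (M.gw H K).delta) :
    (∃ r a, l = Act.snd H r a) ∨ (∃ r a, l = Act.rcv r H a) := by
  rcases ht with ⟨q1, s, a, q2, hd, e | e⟩ | ⟨q1, s, a, q2, hd, e | e⟩ <;>
    simp only [Prod.mk.injEq] at e <;> obtain ⟨rfl, rfl, rfl⟩ := e <;> simp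

/-- a step of the gateway of `H` preserves the invariant -/
theorem inv_step_H {M N : CFSM R A B} {H K : R} {P : Set R} {S : CS R A B}
    (hHK : H ≠ K) (hf : M.HatFree)
    (ha : M.ActsFor H P) (hKP : K ∉ P) (hS : S.mach H = M.gw H K)
    {c c' : Config R A B} (h : Inv M N H K c) {l} (hs : Step S c l c')
    (hl : (∃ r a, l = Act.snd H r a) ∨ (∃ r a, l = Act.rcv r H a)) : Inv M N H K c' := by
  obtain ⟨I, O, I', O', h1, h2, h3, h4⟩ := h
  rcases hl with ⟨r, a, rfl⟩ | ⟨r, a, rfl⟩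
  · obtain ⟨_, ht, hst, hb, hb'⟩ := hs
    rw [hS] at ht
    rw [Inv, hst K hHK.symm, hb' K H (by grind)]
    rcases gw_step hf ha hKP h1 ht with ⟨a, e, _⟩ | ⟨a, e, h⟩ | ⟨⟨s, a, hsK, e | e⟩, h⟩
    · cases e
    · cases e
      exact ⟨_, _, _, _, h, h2, h3, by rw [hb, h4, List.append_assoc]⟩
    · cases e
    · cases e
      exact ⟨_, _, _, _, h, h2, h3, by rw [hb' H K (by grind), h4]⟩
  · obtain ⟨_, ht, hst, hb, hb'⟩ := hs
    rw [hS] at ht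
    rw [Inv, hst K hHK.symm, hb' H K (by grind)]
    rcases gw_step hf ha hKP h1 ht with ⟨a, e, h⟩ | ⟨a, e, h⟩ | ⟨⟨s, a, hsK, e | e⟩, h⟩
    · cases e
      exact ⟨_, _, _, _, h, h2, by rw [h3, hb]; simp, h4⟩
    · cases e
    · cases e
      exact ⟨_, _, _, _, h, h2, by rw [hb' K H (by grind), h3], h4⟩
    · cases e

/-- a step of another role preserves the invariant -/
theorem inv_step_other {M N : CFSM R A B} {H K : R} {S : CS R A B}
    {c c' : Config R A B} (h : Inv M N H K c) {l} (hs : Step S c l c')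
    (hl : ∃ p, p ≠ H ∧ p ≠ K ∧ ((∃ r a, l = Act.snd p r a) ∨ (∃ r a, l = Act.rcv r p a))) :
    Inv M N H K c' := by
  obtain ⟨p, hpH, hpK, ⟨r, a, rfl⟩ | ⟨r, a, rfl⟩⟩ := hl
  all_goals
    obtain ⟨_, ht, hst, hb, hb'⟩ := hs
    rw [Inv, hst K hpK.symm, hst H hpH.symm, hb' H K (by grind), hb' K H (by grind)]
    exact h

theorem gw_trans {M : CFSM R A B} {H K : R} {q l q'} (hq : q ∉ M.hatStates)
    (ht : (q, l, q') ∈ (M.gw H K).delta) :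
    (∃ s a q2, (q, Act.snd H s a, q2) ∈ M.delta ∧ l = Act.rcv K H a) ∨
    (∃ s a q2, (q, Act.rcv s H a, q2) ∈ M.delta ∧ l = Act.rcv s H a) := by
  rcases ht with ⟨q1, s, a, q2, hd, e | e⟩ | ⟨q1, s, a, q2, hd, e | e⟩ <;>
    simp only [Prod.mk.injEq] at e <;> obtain ⟨rfl, rfl, rfl⟩ := e
  · exact Or.inl ⟨_, _, _, hd, rfl⟩
  · exact absurd ⟨_, _, _, hd, rfl⟩ hq
  · exact Or.inr ⟨_, _, _, hd, rfl⟩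
  · exact absurd ⟨_, _, _, hd, rfl⟩ hq

theorem hist_run {M : CFSM R A B} {q I O} (hq : q ∉ M.hatStates) (h : Hist M q I O) :
    ∃ w, Run M q w ∧ O = proj .query w ∧ I = proj .bang w := by
  obtain ⟨w, h1, ⟨h2, h3⟩ | ⟨_, _, _, _, h2, h3, _⟩⟩ := h
  · exact ⟨w, h2, h1, h3⟩
  · exact absurd ⟨_, _, _, h2, h3⟩ hq

end GTIRProof

open GTIRProof

/-- in a reachable configuration of the composed system with all
buffers empty, both gateways in non-intermediate, non-final states, either all
transitions of the gateway of `H` are inputs from `K` and all transitions of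
the gateway of `K` are inputs from `s ≠ H`, or vice versa. -/
theorem stmt5_gateway_input_dichotomy
    {R A B : Type} [Finite R] [Finite A]
    (S1 S2 : CS R A B) (H K : R)
    (hH : H ∈ S1.roles) (hK : K ∈ S2.roles)
    (hdisj : S1.roles ∩ S2.roles = ∅)
    (hcompat : (S1.mach H).Compat (S2.mach K))
    (hwf1 : S1.WF) (hwf2 : S2.WF)
    (hfin1 : S1.FiniteSys) (hfin2 : S2.FiniteSys)
    (hhf1 : (S1.mach H).HatFree) (hhf2 : (S2.mach K).HatFree)
    (c : Config R A B) (hc : Reach (CS.compose S1 S2 H K) c)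
    (hempty : ∀ p ∈ (CS.compose S1 S2 H K).roles,
      ∀ q ∈ (CS.compose S1 S2 H K).roles, c.buf p q = [])
    (hnhatH : c.st H ∉ (S1.mach H).hatStates)
    (hnhatK : c.st K ∉ (S2.mach K).hatStates)
    (hnfinH : ¬ ((S1.mach H).gw H K).Final (c.st H))
    (hnfinK : ¬ ((S2.mach K).gw K H).Final (c.st K)) :
    ((∀ l q', (c.st H, l, q') ∈ ((S1.mach H).gw H K).delta →
        ∃ a, l = Act.rcv K H a) ∧
     (∀ l q', (c.st K, l, q') ∈ ((S2.mach K).gw K H).delta →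
        ∃ s a, s ≠ H ∧ l = Act.rcv s K a)) ∨
    ((∀ l q', (c.st K, l, q') ∈ ((S2.mach K).gw K H).delta →
        ∃ a, l = Act.rcv H K a) ∧
     (∀ l q', (c.st H, l, q') ∈ ((S1.mach H).gw H K).delta →
        ∃ s a, s ≠ K ∧ l = Act.rcv s H a)) := by
  have hKn : K ∉ S1.roles := fun h => by
    have : K ∈ S1.roles ∩ S2.roles := ⟨h, hK⟩
    simp [hdisj] at this
  have hHn : H ∉ S2.roles := fun h => by
    have : H ∈ S1.roles ∩ S2.roles := ⟨hH, h⟩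
    simp [hdisj] at this
  have hHK : H ≠ K := fun h => hKn (h ▸ hH)
  have hSH : (CS.compose S1 S2 H K).mach H = (S1.mach H).gw H K := by simp [CS.compose]
  have hSK : (CS.compose S1 S2 H K).mach K = (S2.mach K).gw K H := by
    simp [CS.compose, hHK.symm]
  have hHr : H ∈ (CS.compose S1 S2 H K).roles := Or.inl hH
  have hKr : K ∈ (CS.compose S1 S2 H K).roles := Or.inr hK
  have hinv : Inv (S1.mach H) (S2.mach K) H K c := by
    clear hempty hnhatH hnhatK hnfinH hnfinK
    obtain ⟨c₀, hi, hr⟩ := hc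
    induction hr with
    | refl =>
      refine ⟨[], [], [], [], ?_, ?_, ?_, ?_⟩
      · rw [hi.1 H hHr, hSH]
        exact ⟨[], rfl, Or.inl ⟨Run.nil, rfl⟩⟩
      · rw [hi.1 K hKr, hSK]
        exact ⟨[], rfl, Or.inl ⟨Run.nil, rfl⟩⟩
      · simp [hi.2 K hKr H hHr]
      · simp [hi.2 H hHr K hKr]
    | tail _ hs ih =>
      obtain ⟨l, hs⟩ := hs
      have hsub : ∃ p, (∃ r a, l = Act.snd p r a) ∨ (∃ r a, l = Act.rcv r p a) := by
        cases l with
        | snd s r a => exact ⟨s, Or.inl ⟨_, _, rfl⟩⟩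
        | rcv s r a => exact ⟨r, Or.inr ⟨_, _, rfl⟩⟩
      obtain ⟨p, hp⟩ := hsub
      by_cases hpH : p = H
      · subst hpH
        exact inv_step_H hHK hhf1 (hwf1 _ hH) hKn hSH ih hs hp
      · by_cases hpK : p = K
        · subst hpK
          exact inv_symm (inv_step_H hHK.symm hhf2 (hwf2 _ hK) hHn hSK (inv_symm ih) hs hp)
        · exact inv_step_other ih hs ⟨p, hpH, hpK, hp⟩
  obtain ⟨I, O, I', O', h1, h2, h3, h4⟩ := hinv
  rw [hempty K hKr H hHr, List.append_nil] at h3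
  rw [hempty H hHr K hKr, List.append_nil] at h4
  obtain ⟨w, hw, rfl, rfl⟩ := hist_run hnhatH h1
  obtain ⟨v, hv, rfl, rfl⟩ := hist_run hnhatK h2
  obtain ⟨hL, hm1, hm2, hd1, hd2⟩ := hcompat
  have hdual : ∀ {q x}, Run (S2.mach K) q x → ∃ q', Run (S1.mach H) q' (dualWord x) := by
    intro q x hx
    rw [← mem_lang, hL]
    exact ⟨x, mem_lang.2 ⟨q, hx⟩, rfl⟩
  obtain ⟨qv, hqv⟩ := hdual hv
  have hwv : w = dualWord v := by
    refine word_eq hm1 hd1 w [] (dualWord v) _ _ hw hqv ?_ ?_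
    · rw [proj_dual_bang, h3]
    · rw [proj_dual_query, h4]
  -- polarity of transitions at the two states
  have hopp : ∀ {l q l' q'}, (c.st H, l, q) ∈ (S1.mach H).delta →
      (c.st K, l', q') ∈ (S2.mach K).delta → l.noC.1 = l'.noC.1.dual := by
    intro l q l' q' hl hl'
    obtain ⟨q2, hq2⟩ := hdual (Run.snoc hv hl')
    have hq3 : Run (S1.mach H) q2 (w ++ [(l'.noC.1.dual, l'.noC.2)]) := by
      rw [hwv]; simpa [dualWord] using hq2
    obtain ⟨q4, l4, hq4, hl4, he⟩ := run_snoc_inv hq3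
    have := run_det hd1 hw hq4
    subst this
    rw [same_pol hm1 hl hl4, he]
  have hsH : ∀ {s a q}, (c.st H, Act.rcv s H a, q) ∈ (S1.mach H).delta → s ≠ K := by
    rintro s a q hq rfl
    obtain ⟨r, b, hr, _, e | e⟩ := hwf1 _ hH _ _ _ hq <;> cases e
    exact hKn hr
  have hsK : ∀ {s a q}, (c.st K, Act.rcv s K a, q) ∈ (S2.mach K).delta → s ≠ H := by
    rintro s a q hq rfl
    obtain ⟨r, b, hr, _, e | e⟩ := hwf2 _ hK _ _ _ hq <;> cases e
    exact hHn hr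
  simp only [CFSM.Final, not_forall, not_not] at hnfinH hnfinK
  obtain ⟨lH, qH, htH⟩ := hnfinH
  obtain ⟨lK, qK, htK⟩ := hnfinK
  have hK0 : ∃ l q, (c.st K, l, q) ∈ (S2.mach K).delta := by
    rcases gw_trans hnhatK htK with ⟨s, a, q, h, _⟩ | ⟨s, a, q, h, _⟩ <;> exact ⟨_, _, h⟩
  obtain ⟨lK0, qK0, hK0⟩ := hK0
  rcases gw_trans hnhatH htH with ⟨s, a, q, h, _⟩ | ⟨s, a, q, h, _⟩
  · left
    constructor
    · intro l q' hl
      rcases gw_trans hnhatH hl with ⟨s', a', q2, h', rfl⟩ | ⟨s', a', q2, h', rfl⟩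
      · exact ⟨_, rfl⟩
      · have := same_pol hm1 h h'
        simp [Act.noC] at this
    · intro l q' hl
      rcases gw_trans hnhatK hl with ⟨s', a', q2, h', rfl⟩ | ⟨s', a', q2, h', rfl⟩
      · have := hopp h h'
        simp [Act.noC, Pol.dual] at this
      · exact ⟨_, _, hsK h', rfl⟩
  · right
    constructor
    · intro l q' hl
      rcases gw_trans hnhatK hl with ⟨s', a', q2, h', rfl⟩ | ⟨s', a', q2, h', rfl⟩
      · exact ⟨_, rfl⟩
      · have := hopp h h'
        simp [Act.noC, Pol.dual] at this
    · intro l q' hl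
      rcases gw_trans hnhatH hl with ⟨s', a', q2, h', rfl⟩ | ⟨s', a', q2, h', rfl⟩
      · have := same_pol hm1 h h'
        simp [Act.noC] at this
      · exact ⟨_, _, hsH h', rfl⟩
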